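/- Suppose that for every y0 ∈ Y the limit v(y0) := lim_{T→∞} v_T(y0) exists (i.e., v_T converges pointwise on Y to a function v) and the limit function v is continuous on Y. Then v(y0) = d*(y0) for every y0 ∈ Y. -/

import Mathlib

open MeasureTheory Filter Set Topology
open scoped ENNReal NNReal

noncomputable section

namespace StochLP

/-- The model of the controlled stochastic discrete time system (controlled stochastic
recursion) `y(t+1) = f(y(t), u(t), s(t))` from the paper: `Y ⊂ ℝⁿ` is a compact forward
invariant state constraint set, `Uc` is a compact metric control space, `S` is a Polish
noise space, `U` is an upper semicontinuous compact valued control constraint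
multifunction (upper semicontinuity of a compact valued map into a compact space being
recorded as closedness of its graph), `f` is bounded, continuous in `(y,u)` and Borel
measurable in `s`, and `ν` is the common law of the i.i.d. noise elements `s(t)`. -/
structure Model (n : ℕ) (Uc S : Type) [MetricSpace Uc] [CompactSpace Uc]
    [MeasurableSpace Uc] [BorelSpace Uc] [TopologicalSpace S] [PolishSpace S]
    [MeasurableSpace S] [BorelSpace S] where
  Y : Set (Fin n → ℝ)
  U : (Fin n → ℝ) → Set Uc
  f : (Fin n → ℝ) → Uc → S → (Fin n → ℝ)
  ν : Measure S
  ν_prob : IsProbabilityMeasure ν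
  Y_compact : IsCompact Y
  Y_nonempty : Y.Nonempty
  U_nonempty : ∀ y ∈ Y, (U y).Nonempty
  U_compact : ∀ y ∈ Y, IsCompact (U y)
  graph_closed : IsClosed {p : (Fin n → ℝ) × Uc | p.1 ∈ Y ∧ p.2 ∈ U p.1}
  f_bounded : ∃ C : ℝ, ∀ y ∈ Y, ∀ (u : Uc) (s : S), ‖f y u s‖ ≤ C
  f_cont : ∀ s : S, ContinuousOn (fun p : (Fin n → ℝ) × Uc => f p.1 p.2 s) (Y ×ˢ univ)
  f_meas : ∀ y ∈ Y, ∀ u : Uc, Measurable fun s => f y u s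
  f_inv : ∀ y ∈ Y, ∀ u ∈ U y, ∀ s : S, f y u s ∈ Y

variable {n : ℕ} {Uc S : Type} [MetricSpace Uc] [CompactSpace Uc] [MeasurableSpace Uc]
  [BorelSpace Uc] [TopologicalSpace S] [PolishSpace S] [MeasurableSpace S] [BorelSpace S]

/-- A control plan: a sequence of Borel measurable selections of the multifunction `U`. -/
structure Plan (M : Model n Uc S) where
  π : ℕ → (Fin n → ℝ) → Uc
  measurable : ∀ t, Measurable (π t)
  feasible : ∀ t, ∀ y ∈ M.Y, π t y ∈ M.U y

/-- The law of the state `y^{π,y₀}(t)` of the controlled stochastic recursion started at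
`y₀` and driven by the i.i.d. noise with common law `ν`, defined by the Markov recursion.  -/
def stateLaw (M : Model n Uc S) (t : ℕ) :
    (ℕ → (Fin n → ℝ) → Uc) → (Fin n → ℝ) → Measure (Fin n → ℝ) :=
  Nat.rec (motive := fun _ => (ℕ → (Fin n → ℝ) → Uc) → (Fin n → ℝ) → Measure (Fin n → ℝ))
    (fun _ y => Measure.dirac y)
    (fun _ ih π y =>
      (M.ν.map fun s => M.f y (π 0 y) s).bind fun y' => ih (fun j => π (j + 1)) y') t

/-- The joint law of the state-control pair `(y^{π,y₀}(t), u^{π,y₀}(t))`. -/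
def saLaw (M : Model n Uc S) (t : ℕ) (π : ℕ → (Fin n → ℝ) → Uc) (y0 : Fin n → ℝ) :
    Measure ((Fin n → ℝ) × Uc) :=
  (stateLaw M t π y0).map fun z => (z, π t z)

/-- `E[q(y^{π,y₀}(t), u^{π,y₀}(t))]`. -/
def expSA (M : Model n Uc S) (t : ℕ) (π : ℕ → (Fin n → ℝ) → Uc) (y0 : Fin n → ℝ)
    (q : (Fin n → ℝ) → Uc → ℝ) : ℝ :=
  ∫ p, q p.1 p.2 ∂saLaw M t π y0

/-- The finite horizon average expected cost `(1/T) E[Σ_{t=0}^{T-1} k(y(t),u(t))]`. -/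
def costT (M : Model n Uc S) (k : (Fin n → ℝ) → Uc → ℝ) (T : ℕ) (π : ℕ → (Fin n → ℝ) → Uc)
    (y0 : Fin n → ℝ) : ℝ :=
  (1 / (T : ℝ)) * ∑ t ∈ Finset.range T, expSA M t π y0 k

/-- The optimal value `v_T(y₀)` of the finite horizon problem. -/
def vT (M : Model n Uc S) (k : (Fin n → ℝ) → Uc → ℝ) (T : ℕ) (y0 : Fin n → ℝ) : ℝ :=
  ⨅ π : Plan M, costT M k T π.π y0

/-- The expected discounted cost `ε Σ_{t=0}^∞ (1-ε)^t E[k(y(t),u(t))]`. -/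
def costDisc (M : Model n Uc S) (k : (Fin n → ℝ) → Uc → ℝ) (ε : ℝ)
    (π : ℕ → (Fin n → ℝ) → Uc) (y0 : Fin n → ℝ) : ℝ :=
  ε * ∑' t : ℕ, (1 - ε) ^ t * expSA M t π y0 k

/-- The optimal value `h_ε(y₀)` of the discounted problem. -/
def hEps (M : Model n Uc S) (k : (Fin n → ℝ) → Uc → ℝ) (ε : ℝ) (y0 : Fin n → ℝ) : ℝ :=
  ⨅ π : Plan M, costDisc M k ε π.π y0

/-- The graph `G` of the multifunction `U`. -/
def graphG (M : Model n Uc S) : Set ((Fin n → ℝ) × Uc) := {p | p.1 ∈ M.Y ∧ p.2 ∈ M.U p.1}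

/-- `E[φ(f(y,u,s))]`, the expectation over the noise of `φ` evaluated after one step. -/
def Ef (M : Model n Uc S) (φ : (Fin n → ℝ) → ℝ) (y : Fin n → ℝ) (u : Uc) : ℝ :=
  ∫ s, φ (M.f y u s) ∂M.ν

/-- A measure on `Y × Uc` is concentrated on the graph `G` (this encodes measures defined
on Borel subsets of `G`). -/
def onG (M : Model n Uc S) (γ : Measure ((Fin n → ℝ) × Uc)) : Prop := γ (graphG M)ᶜ = 0

/-- The set `W` of stationary measures. -/
def Wset (M : Model n Uc S) : Set (Measure ((Fin n → ℝ) × Uc)) :=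
  {γ | IsProbabilityMeasure γ ∧ onG M γ ∧
    ∀ φ : (Fin n → ℝ) → ℝ, Continuous φ → ∫ p, (Ef M φ p.1 p.2 - φ p.1) ∂γ = 0}

/-- The set `W(ε, y₀)` of discounted stationary measures. -/
def Weps (M : Model n Uc S) (ε : ℝ) (y0 : Fin n → ℝ) : Set (Measure ((Fin n → ℝ) × Uc)) :=
  {γ | IsProbabilityMeasure γ ∧ onG M γ ∧
    ∀ φ : (Fin n → ℝ) → ℝ, Continuous φ →
      ∫ p, ((1 - ε) * (Ef M φ p.1 p.2 - φ p.1) + ε * (φ y0 - φ p.1)) ∂γ = 0}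

/-- The optimal value `k*(ε, y₀)` of the IDLP problem over `W(ε, y₀)`. -/
def kStarEps (M : Model n Uc S) (k : (Fin n → ℝ) → Uc → ℝ) (ε : ℝ) (y0 : Fin n → ℝ) : ℝ :=
  sInf ((fun γ : Measure ((Fin n → ℝ) × Uc) => ∫ p, k p.1 p.2 ∂γ) '' Weps M ε y0)

/-- The optimal value `k*` of the IDLP problem over `W`. -/
def kStar (M : Model n Uc S) (k : (Fin n → ℝ) → Uc → ℝ) : ℝ :=
  sInf ((fun γ : Measure ((Fin n → ℝ) × Uc) => ∫ p, k p.1 p.2 ∂γ) '' Wset M)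

/-- The optimal value `μ*(ε, y₀)` of the problem dual to the IDLP problem over `W(ε,y₀)`. -/
def muStarEps (M : Model n Uc S) (k : (Fin n → ℝ) → Uc → ℝ) (ε : ℝ) (y0 : Fin n → ℝ) : ℝ :=
  sSup {r : ℝ | ∃ ψ : (Fin n → ℝ) → ℝ, Continuous ψ ∧
    r = sInf ((fun p : (Fin n → ℝ) × Uc =>
      k p.1 p.2 + (1 - ε) * (Ef M ψ p.1 p.2 - ψ p.1) + ε * (ψ y0 - ψ p.1)) '' graphG M)}

/-- The optimal value `μ*` of the problem dual to the IDLP problem over `W`. -/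
def muStar (M : Model n Uc S) (k : (Fin n → ℝ) → Uc → ℝ) : ℝ :=
  sSup {r : ℝ | ∃ ψ : (Fin n → ℝ) → ℝ, Continuous ψ ∧
    r = sInf ((fun p : (Fin n → ℝ) × Uc => k p.1 p.2 + Ef M ψ p.1 p.2 - ψ p.1) '' graphG M)}

/-- The feasible set `Ω(y₀)` of the augmented IDLP problem. -/
def OmegaSet (M : Model n Uc S) (y0 : Fin n → ℝ) :
    Set (Measure ((Fin n → ℝ) × Uc) × Measure ((Fin n → ℝ) × Uc)) :=
  {p | p.1 ∈ Wset M ∧ IsFiniteMeasure p.2 ∧ onG M p.2 ∧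
    ∀ φ : (Fin n → ℝ) → ℝ, Continuous φ →
      ∫ q, (φ y0 - φ q.1) ∂p.1 + ∫ q, (Ef M φ q.1 q.2 - φ q.1) ∂p.2 = 0}

/-- The optimal value `k*(y₀)` of the augmented IDLP problem. -/
def kStarAug (M : Model n Uc S) (k : (Fin n → ℝ) → Uc → ℝ) (y0 : Fin n → ℝ) : ℝ :=
  sInf ((fun p : Measure ((Fin n → ℝ) × Uc) × Measure ((Fin n → ℝ) × Uc) =>
    ∫ q, k q.1 q.2 ∂p.1) '' OmegaSet M y0)

/-- Feasibility of `(μ, ψ, η)` for the problem dual to the augmented IDLP problem. -/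
def DualFeas (M : Model n Uc S) (k : (Fin n → ℝ) → Uc → ℝ) (y0 : Fin n → ℝ)
    (ψ η : (Fin n → ℝ) → ℝ) (μ : ℝ) : Prop :=
  (∀ p ∈ graphG M, 0 ≤ k p.1 p.2 + (ψ y0 - ψ p.1) + Ef M η p.1 p.2 - η p.1 - μ) ∧
  (∀ p ∈ graphG M, 0 ≤ Ef M ψ p.1 p.2 - ψ p.1)

/-- The optimal value `d*(y₀)` of the dual (with continuous test functions) of the
augmented IDLP problem. -/
def dStar (M : Model n Uc S) (k : (Fin n → ℝ) → Uc → ℝ) (y0 : Fin n → ℝ) : ℝ :=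
  sSup {μ : ℝ | ∃ ψ η : (Fin n → ℝ) → ℝ, Continuous ψ ∧ Continuous η ∧
    DualFeas M k y0 ψ η μ}

/-- Bounded Borel measurable real valued functions. -/
def BddBorel (ψ : (Fin n → ℝ) → ℝ) : Prop := Measurable ψ ∧ ∃ C : ℝ, ∀ y, |ψ y| ≤ C

/-- The optimal value `d̂*(y₀)` of the relaxed dual (with bounded Borel test functions) of
the augmented IDLP problem. -/
def dHatStar (M : Model n Uc S) (k : (Fin n → ℝ) → Uc → ℝ) (y0 : Fin n → ℝ) : ℝ :=
  sSup {μ : ℝ | ∃ ψ η : (Fin n → ℝ) → ℝ, BddBorel ψ ∧ BddBorel η ∧ DualFeas M k y0 ψ η μ}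

/-- The occupational measure `γ^{π,y₀,T}`. -/
def occT (M : Model n Uc S) (T : ℕ) (π : ℕ → (Fin n → ℝ) → Uc) (y0 : Fin n → ℝ) :
    Measure ((Fin n → ℝ) × Uc) :=
  (T : ℝ≥0∞)⁻¹ • ∑ t ∈ Finset.range T, saLaw M t π y0

/-- The discounted occupational measure `γ_d^{π,y₀,ε}`. -/
def discOcc (M : Model n Uc S) (ε : ℝ) (π : ℕ → (Fin n → ℝ) → Uc) (y0 : Fin n → ℝ) :
    Measure ((Fin n → ℝ) × Uc) :=
  ENNReal.ofReal ε • Measure.sum fun t : ℕ => ENNReal.ofReal (1 - ε) ^ t • saLaw M t π y0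

/-- The set `Θ_ε(y₀)` of discounted occupational measures, as a set of probability
measures (carrying the topology of weak convergence). -/
def ThetaEps (M : Model n Uc S) (ε : ℝ) (y0 : Fin n → ℝ) :
    Set (ProbabilityMeasure ((Fin n → ℝ) × Uc)) :=
  {μ | ∃ π : Plan M, μ.toMeasure = discOcc M ε π.π y0}

/-- `Θ_ε := ∪_{y₀ ∈ Y} Θ_ε(y₀)`. -/
def ThetaEpsAll (M : Model n Uc S) (ε : ℝ) : Set (ProbabilityMeasure ((Fin n → ℝ) × Uc)) :=
  ⋃ y0 ∈ M.Y, ThetaEps M ε y0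

/-- The set `Γ_T(y₀)` of occupational measures. -/
def GammaT (M : Model n Uc S) (T : ℕ) (y0 : Fin n → ℝ) :
    Set (ProbabilityMeasure ((Fin n → ℝ) × Uc)) :=
  {μ | ∃ π : Plan M, μ.toMeasure = occT M T π.π y0}

/-- `Γ_T := ∪_{y₀ ∈ Y} Γ_T(y₀)`. -/
def GammaTAll (M : Model n Uc S) (T : ℕ) : Set (ProbabilityMeasure ((Fin n → ℝ) × Uc)) :=
  ⋃ y0 ∈ M.Y, GammaT M T y0

/-- `W` as a set of probability measures. -/
def WsetPM (M : Model n Uc S) : Set (ProbabilityMeasure ((Fin n → ℝ) × Uc)) :=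
  {μ | μ.toMeasure ∈ Wset M}

/-- `W(ε,y₀)` as a set of probability measures. -/
def WepsPM (M : Model n Uc S) (ε : ℝ) (y0 : Fin n → ℝ) :
    Set (ProbabilityMeasure ((Fin n → ℝ) × Uc)) :=
  {μ | μ.toMeasure ∈ Weps M ε y0}

/-- The set of finite convex combinations of elements of a set of probability measures,
i.e. its convex hull. -/
def convexCombos {α : Type*} [MeasurableSpace α] (A : Set (ProbabilityMeasure α)) :
    Set (ProbabilityMeasure α) :=
  {μ | ∃ (m : ℕ) (w : Fin m → ℝ≥0) (γ : Fin m → ProbabilityMeasure α),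
    (∀ i, γ i ∈ A) ∧ (∑ i, w i) = 1 ∧
    μ.toMeasure = ∑ i, (w i : ℝ≥0∞) • (γ i).toMeasure}

/-- Membership in the set `D₁(y₀)`. -/
def D1mem (M : Model n Uc S) (y0 : Fin n → ℝ) (γ : Measure ((Fin n → ℝ) × Uc)) : Prop :=
  ∃ ξ : ℕ → Measure ((Fin n → ℝ) × Uc),
    (∀ l, IsFiniteMeasure (ξ l) ∧ onG M (ξ l)) ∧
    ∀ φ : (Fin n → ℝ) → ℝ, Continuous φ →
      Tendsto (fun l => ∫ q, (Ef M φ q.1 q.2 - φ q.1) ∂ξ l) atTop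
        (𝓝 (∫ q, (φ q.1 - φ y0) ∂γ))

/-- A control plan is periodic regime generating (PRG) for the initial point `y₀`. -/
def IsPRG (M : Model n Uc S) (π : Plan M) (y0 : Fin n → ℝ) : Prop :=
  ∃ T0 Tp : ℕ, 0 < Tp ∧
    ∀ q : ((Fin n → ℝ) × Uc) → ℝ, Continuous q →
      ∀ t, T0 ≤ t → ∫ p, q p ∂saLaw M t π.π y0 = ∫ p, q p ∂saLaw M (t + Tp) π.π y0

/-- The optimal value `V_per(y₀)` over periodic regime generating control plans. -/
def Vper (M : Model n Uc S) (k : (Fin n → ℝ) → Uc → ℝ) (y0 : Fin n → ℝ) : ℝ :=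
  sInf {c : ℝ | ∃ π : Plan M, IsPRG M π y0 ∧
    Tendsto (fun T => costT M k T π.π y0) atTop (𝓝 c)}

/-- The optimal value `k*_θ(y₀)` of the perturbed augmented IDLP problem. -/
def kStarTheta (M : Model n Uc S) (k θ : (Fin n → ℝ) → Uc → ℝ) (y0 : Fin n → ℝ) : ℝ :=
  sInf ((fun p : Measure ((Fin n → ℝ) × Uc) × Measure ((Fin n → ℝ) × Uc) =>
    ∫ q, k q.1 q.2 ∂p.1 + ∫ q, θ q.1 q.2 ∂p.2) '' OmegaSet M y0)

/-- Feasibility of `(μ, ψ, η)` for the perturbed dual problem. -/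
def DualFeasTheta (M : Model n Uc S) (k θ : (Fin n → ℝ) → Uc → ℝ) (y0 : Fin n → ℝ)
    (ψ η : (Fin n → ℝ) → ℝ) (μ : ℝ) : Prop :=
  (∀ p ∈ graphG M, 0 ≤ k p.1 p.2 + (ψ y0 - ψ p.1) + Ef M η p.1 p.2 - η p.1 - μ) ∧
  (∀ p ∈ graphG M, -θ p.1 p.2 ≤ Ef M ψ p.1 p.2 - ψ p.1)

/-- The optimal value `d*_θ(y₀)` of the perturbed dual problem. -/
def dStarTheta (M : Model n Uc S) (k θ : (Fin n → ℝ) → Uc → ℝ) (y0 : Fin n → ℝ) : ℝ :=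
  sSup {μ : ℝ | ∃ ψ η : (Fin n → ℝ) → ℝ, Continuous ψ ∧ Continuous η ∧
    DualFeasTheta M k θ y0 ψ η μ}

/-- The optimal value `d̄*_θ(y₀)` of the second form of the perturbed dual problem. -/
def dBarTheta (M : Model n Uc S) (k θ : (Fin n → ℝ) → Uc → ℝ) (y0 : Fin n → ℝ) : ℝ :=
  sSup {r : ℝ | ∃ ψ η : (Fin n → ℝ) → ℝ, Continuous ψ ∧ Continuous η ∧ r = ψ y0 ∧
    (∀ p ∈ graphG M, 0 ≤ k p.1 p.2 - ψ p.1 + Ef M η p.1 p.2 - η p.1) ∧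
    (∀ p ∈ graphG M, -θ p.1 p.2 ≤ Ef M ψ p.1 p.2 - ψ p.1)}

section Abstract

variable {X G S : Type*} [MetricSpace X] [CompactSpace X] [MeasurableSpace X] [BorelSpace X]
  [MetricSpace G] [CompactSpace G] [MeasurableSpace G] [BorelSpace G]
  [MeasurableSpace S] {ν : Measure S} [IsProbabilityMeasure ν]

omit [CompactSpace X] in
/-- A lower semicontinuous function on a compact metric fibration attains its minimum over the
fibres along a Borel section, and the minimum is lower semicontinuous. -/
theorem exists_measurable_argmin_section {p : G → X} (hp : Continuous p)
    (hps : Function.Surjective p) {h : G → ℝ≥0∞} (hh : LowerSemicontinuous h) :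
    ∃ σ : X → G, Measurable σ ∧ (∀ x, p (σ x) = x) ∧ (∀ g, h (σ (p g)) ≤ h g) ∧
      LowerSemicontinuous fun x => h (σ x) := by
  rcases isEmpty_or_nonempty G with hG | hG
  · have : IsEmpty X := ⟨fun x => hG.elim (hps x).choose⟩
    exact ⟨fun x => isEmptyElim x, measurable_of_empty _, fun x => isEmptyElim x,
      fun g => isEmptyElim g, fun x => isEmptyElim x⟩
  obtain ⟨q₀, hq₀, hq₀s⟩ := exists_nat_bool_continuous_surjective_of_compact G
  let q : cantorSet → G := q₀ ∘ cantorSetHomeomorphNatToBool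
  have hq : Continuous q := hq₀.comp cantorSetHomeomorphNatToBool.continuous
  have hqs : Function.Surjective q := hq₀s.comp cantorSetHomeomorphNatToBool.surjective
  have : CompactSpace cantorSet := isCompact_iff_compactSpace.1 isCompact_cantorSet
  have hhq : LowerSemicontinuous (h ∘ q) := hh.comp hq
  have hclosed (r : ℝ≥0∞) : IsClosed {z | h (q z) ≤ r} := hhq.isClosed_preimage r
  have hfib (x : X) : IsClosed {z | p (q z) = x} :=
    isClosed_singleton.preimage (hp.comp hq)
  have hmin (x : X) : ∃ z, p (q z) = x ∧ ∀ g, p g = x → h (q z) ≤ h g := by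
    obtain ⟨g, hg⟩ := hps x
    obtain ⟨z, rfl⟩ := hqs g
    obtain ⟨z', hz', hm⟩ := LowerSemicontinuousOn.exists_isMinOn (s := {z | p (q z) = x})
      ⟨z, hg⟩ (hfib x).isCompact (hhq.lowerSemicontinuousOn _)
    refine ⟨z', hz', fun g' hg' => ?_⟩
    obtain ⟨w, rfl⟩ := hqs g'
    exact hm hg'
  have hleast (x : X) :
      ∃ z, IsLeast {z | p (q z) = x ∧ ∀ g, p g = x → h (q z) ≤ h g} z := by
    obtain ⟨z, hz⟩ := hmin x
    refine IsCompact.exists_isLeast (IsClosed.isCompact ?_) ⟨z, hz⟩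
    have : {z | p (q z) = x ∧ ∀ g, p g = x → h (q z) ≤ h g} =
        {z | p (q z) = x} ∩ ⋂ g, ⋂ (_ : p g = x), {z | h (q z) ≤ h g} := by
      ext; simp
    rw [this]
    exact (hfib x).inter (isClosed_iInter fun g => isClosed_iInter fun _ => hclosed _)
  choose ζ hζ using hleast
  have hsec (x : X) : p (q (ζ x)) = x := (hζ x).1.1
  have hopt (g : G) : h (q (ζ (p g))) ≤ h g := (hζ (p g)).1.2 g rfl
  have hle (c : ℝ) : IsClosed {z : cantorSet | (z : ℝ) ≤ c} :=
    isClosed_Iic.preimage continuous_subtype_val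
  let A (r : ℝ≥0∞) : Set X := (p ∘ q) '' {z | h (q z) ≤ r}
  let B (c : ℝ) (r : ℝ≥0∞) : Set X := (p ∘ q) '' ({z : cantorSet | (z : ℝ) ≤ c} ∩ {z | h (q z) ≤ r})
  have hA (r : ℝ≥0∞) : IsClosed (A r) :=
    ((hclosed r).isCompact.image (hp.comp hq)).isClosed
  have hB (c : ℝ) (r : ℝ≥0∞) : IsClosed (B c r) :=
    (((hle c).inter (hclosed r)).isCompact.image (hp.comp hq)).isClosed
  obtain ⟨D, hDc, hD⟩ := TopologicalSpace.exists_countable_dense ℝ≥0∞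
  have hIic (c : ℝ) : (fun x => (ζ x : ℝ)) ⁻¹' Iic c = ⋂ r ∈ insert ⊤ D, (A r)ᶜ ∪ B c r := by
    ext x
    simp only [mem_preimage, mem_Iic, mem_iInter, mem_union, mem_compl_iff]
    constructor
    · intro hx r _
      refine or_iff_not_imp_left.2 fun hxr => ?_
      obtain ⟨z, hz, rfl⟩ := not_not.1 hxr
      exact ⟨ζ _, ⟨hx, (hopt (q z)).trans hz⟩, hsec _⟩
    · intro hx
      have hx' (r) (hr : r ∈ insert ⊤ D) (hxr : x ∈ A r) : x ∈ B c r :=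
        (hx r hr).resolve_left (not_not.2 hxr)
      obtain ⟨z₁, hz₁, hz₁x⟩ := hx' ⊤ (mem_insert _ _) ⟨ζ x, le_top (a := h (q (ζ x))), hsec x⟩
      obtain ⟨z, ⟨hzc, hzx⟩, hz⟩ := LowerSemicontinuousOn.exists_isMinOn
        (s := {z : cantorSet | (z : ℝ) ≤ c} ∩ {z | p (q z) = x}) ⟨z₁, hz₁.1, hz₁x⟩
        ((hle c).inter (hfib x)).isCompact (hhq.lowerSemicontinuousOn _)
      have hzζ : h (q z) ≤ h (q (ζ x)) := by
        by_contra! hlt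
        obtain ⟨r, hrD, hr⟩ := hD.exists_between hlt
        obtain ⟨z₂, hz₂, hz₂x⟩ := hx' r (mem_insert_of_mem _ hrD) ⟨ζ x, hr.1.le, hsec x⟩
        exact absurd ((hz ⟨hz₂.1, hz₂x⟩).trans hz₂.2) (not_le.2 hr.2)
      refine le_trans (Subtype.coe_le_coe.2 ((hζ x).2 ⟨hzx, fun g hg => ?_⟩)) hzc
      subst hg
      exact hzζ.trans (hopt g)
  have hζm : Measurable fun x => (ζ x : ℝ) := by
    refine measurable_of_Iic fun c => ?_
    rw [hIic]
    exact MeasurableSet.biInter (hDc.insert _) fun r _ =>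
      (hA r).measurableSet.compl.union (hB c r).measurableSet
  refine ⟨q ∘ ζ, hq.measurable.comp hζm.subtype_mk, hsec, hopt, ?_⟩
  refine lowerSemicontinuous_iff_isClosed_preimage.2 fun r => ?_
  convert hA r using 1
  ext x
  refine ⟨fun hx => ⟨ζ x, hx, hsec x⟩, ?_⟩
  rintro ⟨z, hz, rfl⟩
  exact (hopt (q z)).trans hz

variable {F : G → S → X}

omit [CompactSpace X] in
theorem measurable_uncurry_dynamics (hFc : ∀ s, Continuous fun g => F g s)
    (hFm : ∀ g, Measurable (F g)) : Measurable (Function.uncurry F) :=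
  measurable_uncurry_of_continuous_of_measurable hFc hFm

omit [CompactSpace X] [BorelSpace G] [CompactSpace G] [IsProbabilityMeasure ν]
  [MeasurableSpace G] in
theorem lowerSemicontinuous_lintegral_dynamics (hFc : ∀ s, Continuous fun g => F g s)
    (hFm : ∀ g, Measurable (F g)) {W : X → ℝ≥0∞} (hW : LowerSemicontinuous W) :
    LowerSemicontinuous fun g => ∫⁻ s, W (F g s) ∂ν := by
  refine lowerSemicontinuous_iff_le_liminf.2 fun g => ?_
  refine le_trans (lintegral_mono fun s => ?_)
    (lintegral_liminf_le fun g' => hW.measurable.comp (hFm g'))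
  exact lowerSemicontinuous_iff_le_liminf.1 (hW.comp (hFc s)) g

omit [CompactSpace X] in
theorem integral_eq_of_forall_continuous_integral_eq {p : G → X} (hp : Continuous p)
    (hFc : ∀ s, Continuous fun g => F g s) (hFm : ∀ g, Measurable (F g))
    {γ : Measure G} [IsFiniteMeasure γ]
    (hγ : ∀ η : C(X, ℝ), ∫ g, ∫ s, η (F g s) ∂ν ∂γ = ∫ g, η (p g) ∂γ)
    {w : X → ℝ} (hw : Measurable w) {B : ℝ} (hB : ∀ x, |w x| ≤ B) :
    ∫ g, ∫ s, w (F g s) ∂ν ∂γ = ∫ g, w (p g) ∂γ := by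
  have hF := measurable_uncurry_dynamics hFc hFm
  have key (w : X → ℝ) (hw : Measurable w) (B : ℝ) (hB : ∀ x, |w x| ≤ B) :
      ∫ x, w x ∂((γ.prod ν).map (Function.uncurry F)) = ∫ g, ∫ s, w (F g s) ∂ν ∂γ := by
    rw [integral_map hF.aemeasurable hw.aestronglyMeasurable,
      integral_prod (fun z => w (Function.uncurry F z))
      (Integrable.of_bound (hw.comp hF).aestronglyMeasurable B (.of_forall fun z => hB _))]
    rfl
  have hmap : (γ.prod ν).map (Function.uncurry F) = γ.map p := by
    refine ext_of_forall_integral_eq_of_IsFiniteMeasure fun η => ?_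
    rw [key η η.continuous.measurable ‖η‖ η.norm_coe_le_norm,
      integral_map hp.measurable.aemeasurable η.continuous.aestronglyMeasurable]
    exact hγ η.toContinuousMap
  rw [← key w hw B hB, hmap,
    integral_map hp.measurable.aemeasurable hw.aestronglyMeasurable]

omit [CompactSpace G] [MeasurableSpace G] [BorelSpace G] in
theorem continuous_integral_dynamics (hFc : ∀ s, Continuous fun g => F g s)
    (hFm : ∀ g, Measurable (F g)) (η : C(X, ℝ)) : Continuous fun g => ∫ s, η (F g s) ∂ν :=
  continuous_of_dominated (bound := fun _ => ‖η‖)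
    (fun g => (η.continuous.measurable.comp (hFm g)).aestronglyMeasurable)
    (fun _ => .of_forall fun _ => η.norm_coe_le_norm _) (integrable_const _)
    (.of_forall fun s => η.continuous.comp (hFc s))

/-- The generator `η ↦ E[η(F(·,s))] - η ∘ p` on continuous functions. -/
def generator (ν : Measure S) [IsProbabilityMeasure ν] (p : C(G, X))
    (hFc : ∀ s, Continuous fun g => F g s)
    (hFm : ∀ g, Measurable (F g)) : C(X, ℝ) →ₗ[ℝ] C(G, ℝ) where
  toFun η := ⟨fun g => ∫ s, η (F g s) ∂ν - η (p g),
    (continuous_integral_dynamics hFc hFm η).sub (η.continuous.comp p.continuous)⟩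
  map_add' η θ := by
    ext g
    have hinteg (η : C(X, ℝ)) : Integrable (fun s => η (F g s)) ν :=
      .of_bound (η.continuous.measurable.comp (hFm g)).aestronglyMeasurable ‖η‖
        (.of_forall fun _ => η.norm_coe_le_norm _)
    simp only [ContinuousMap.add_apply, ContinuousMap.coe_mk]
    rw [integral_add (hinteg η) (hinteg θ)]
    ring
  map_smul' c η := by
    ext g
    simp only [ContinuousMap.smul_apply, ContinuousMap.coe_mk, smul_eq_mul, RingHom.id_apply,
      integral_const_mul]
    ring

theorem exists_measure_of_positive (Λ : C(G, ℝ) →ₗ[ℝ] ℝ) (hΛ : ∀ φ, 0 ≤ φ → 0 ≤ Λ φ) :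
    ∃ γ : Measure G, IsFiniteMeasure γ ∧ ∀ φ : C(G, ℝ), ∫ g, φ g ∂γ = Λ φ := by
  let Λ' : CompactlySupportedContinuousMap G ℝ →ₚ[ℝ] ℝ := PositiveLinearMap.mk₀
    { toFun := fun φ => Λ φ.toContinuousMap
      map_add' := fun φ θ => Λ.map_add _ _
      map_smul' := fun c φ => Λ.map_smul _ _ } fun φ hφ => hΛ _ hφ
  exact ⟨RealRMK.rieszMeasure Λ', inferInstance, fun φ =>
    RealRMK.integral_rieszMeasure Λ' (CompactlySupportedContinuousMap.continuousMapEquiv φ)⟩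

/-- Linear programming duality: if `a` integrates nonnegatively against every invariant measure,
then it is nonnegative up to the generator and an arbitrarily small error. -/
theorem exists_generator_lower_bound {p : G → X} (hp : Continuous p)
    (hFc : ∀ s, Continuous fun g => F g s) (hFm : ∀ g, Measurable (F g)) {a : G → ℝ}
    (ha : Continuous a)
    (hinv : ∀ γ : Measure G, IsFiniteMeasure γ →
      (∀ η : C(X, ℝ), ∫ g, ∫ s, η (F g s) ∂ν ∂γ = ∫ g, η (p g) ∂γ) → 0 ≤ ∫ g, a g ∂γ)
    {ε : ℝ} (hε : 0 < ε) :
    ∃ η : C(X, ℝ), ∀ g, 0 < a g + ε + (∫ s, η (F g s) ∂ν - η (p g)) := by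
  let L := generator ν ⟨p, hp⟩ hFc hFm
  let b : C(G, ℝ) := ⟨fun g => a g + ε, ha.add continuous_const⟩
  let P : Set C(G, ℝ) := {φ | ∀ g, 0 < φ g}
  by_contra! hcon
  have hPconv : Convex ℝ P := by
    intro φ hφ θ hθ r t hr ht hrt g
    have h1 := hφ g
    have h2 := hθ g
    simp only [ContinuousMap.add_apply, ContinuousMap.smul_apply, smul_eq_mul]
    rcases hr.eq_or_lt with rfl | hr
    · have : t = 1 := by linarith
      simp [this, h2]
    · nlinarith [mul_pos hr h1, mul_nonneg ht h2.le]
  have hPopen : IsOpen P := by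
    have : P = {φ : C(G, ℝ) | MapsTo φ univ (Ioi 0)} := by
      ext φ; simp [P, MapsTo]
    rw [this]
    exact ContinuousMap.isOpen_setOfPred_mapsTo isCompact_univ isOpen_Ioi
  have hQconv : Convex ℝ (range fun η => b + L η) := by
    rintro _ ⟨η, rfl⟩ _ ⟨θ, rfl⟩ r t hr ht hrt
    refine ⟨r • η + t • θ, ?_⟩
    simp only [map_add, map_smul, smul_add]
    have : b = r • b + t • b := by rw [← add_smul, hrt, one_smul]
    nth_rewrite 1 [this]
    abel
  have hdisj : Disjoint P (range fun η => b + L η) := by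
    rw [Set.disjoint_right]
    rintro _ ⟨η, rfl⟩ hη
    obtain ⟨g, hg⟩ := hcon η
    exact absurd (hη g) (not_lt.2 hg)
  obtain ⟨f, u, hfP, hfQ⟩ := geometric_hahn_banach_open hPconv hPopen hQconv hdisj
  have hone : f 1 < u := hfP 1 fun g => by simp
  have hpos (φ : C(G, ℝ)) (hφ : 0 ≤ φ) : f φ ≤ 0 := by
    by_contra! h
    obtain ⟨N, hN⟩ := exists_nat_gt ((u - f 1) / f φ)
    have := hfP (1 + (N : ℝ) • φ) fun g => by
      have : 0 ≤ φ g := hφ g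
      simp only [ContinuousMap.add_apply, ContinuousMap.smul_apply, smul_eq_mul,
        ContinuousMap.one_apply]
      positivity
    rw [div_lt_iff₀ h] at hN
    simp only [map_add, map_smul, smul_eq_mul] at this
    linarith
  have hu : 0 ≤ u := by
    by_contra! h
    have h1 : f 1 < 0 := hone.trans h
    have := hfP ((u / f 1) • 1) fun g => by
      have := div_pos_of_neg_of_neg h h1
      simpa using this
    rw [map_smul, smul_eq_mul, div_mul_cancel₀ _ h1.ne] at this
    exact lt_irrefl _ this
  have hL (η : C(X, ℝ)) : f (L η) = 0 := by
    by_contra h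
    have := hfQ (b + L (((u - f b - 1) / f (L η)) • η)) ⟨_, rfl⟩
    rw [map_smul, map_add, map_smul, smul_eq_mul, div_mul_cancel₀ _ h] at this
    linarith
  obtain ⟨γ, hγ, hγf⟩ := exists_measure_of_positive (-(f : C(G, ℝ) →ₗ[ℝ] ℝ)) fun φ hφ => by
    simpa using hpos φ hφ
  have hinteg (φ : C(G, ℝ)) : Integrable φ γ :=
    .of_bound φ.continuous.aestronglyMeasurable ‖φ‖ (.of_forall fun _ => φ.norm_coe_le_norm _)
  have hag : 0 ≤ ∫ g, a g ∂γ := by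
    refine hinv γ hγ fun η => ?_
    have h0 : ∫ g, L η g ∂γ = 0 := by simp [hγf, hL]
    have h1 := integral_sub (hinteg ⟨_, continuous_integral_dynamics (ν := ν) hFc hFm η⟩)
      (hinteg (η.comp ⟨p, hp⟩))
    exact sub_eq_zero.1 (h1.symm.trans h0)
  have hb : f b = -(∫ g, a g ∂γ + ε * γ.real univ) := by
    have h1 : ∫ g, b g ∂γ = - f b := by simp [hγf]
    have h2 : ∫ g, b g ∂γ = ∫ g, a g ∂γ + ∫ _g, ε ∂γ :=
      integral_add (hinteg ⟨a, ha⟩) (integrable_const _)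
    rw [integral_const, smul_eq_mul] at h2
    linarith
  have hb' : u ≤ f b := by simpa using hfQ (b + L 0) ⟨0, rfl⟩
  have hγ1 : γ.real univ = - f 1 := by
    have h1 : ∫ g, (1 : C(G, ℝ)) g ∂γ = - f 1 := (hγf 1).trans rfl
    simpa using h1
  have hγ0 : γ.real univ ≤ 0 := by
    by_contra! h
    linarith [mul_pos hε h]
  linarith [mul_nonneg hε.le (measureReal_nonneg (μ := γ) (s := univ))]

section ValueIteration

variable {p : G → X} {k : G → ℝ} {w : ℕ → X → ℝ} {C : ℝ}

omit [CompactSpace X] [BorelSpace X] [MetricSpace X] [MetricSpace G] [CompactSpace G]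
  [MeasurableSpace G] [BorelSpace G] in
theorem integrable_dynamics (hFm : ∀ g, Measurable (F g)) {φ : X → ℝ} (hφ : Measurable φ) {B : ℝ}
    (hB : ∀ x, |φ x| ≤ B) (g : G) : Integrable (fun s => φ (F g s)) ν :=
  .of_bound (hφ.comp (hFm g)).aestronglyMeasurable B (.of_forall fun _ => hB _)

theorem abs_div_natCast_le {a C : ℝ} (hC : 0 ≤ C) {T : ℕ} (h : |a| ≤ T * C) : |a / T| ≤ C := by
  rcases T.eq_zero_or_pos with rfl | hT
  · simpa using hC
  · rw [abs_div, Nat.abs_cast, div_le_iff₀ (by positivity)]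
    linarith

omit [MetricSpace X] [CompactSpace X] [BorelSpace X] [MetricSpace G] [CompactSpace G]
  [MeasurableSpace G] [BorelSpace G] in
theorem le_integral_of_tendsto_value (hFm : ∀ g, Measurable (F g)) (hC : 0 ≤ C)
    (hwm : ∀ T, Measurable (w T)) (hwC : ∀ T x, |w T x| ≤ T * C)
    (hw : ∀ T g, w (T + 1) (p g) ≤ k g + ∫ s, w T (F g s) ∂ν)
    {v : X → ℝ} (hv : ∀ x, Tendsto (fun T : ℕ => w T x / T) atTop (𝓝 (v x))) (g : G) :
    v (p g) ≤ ∫ s, v (F g s) ∂ν := by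
  have hlim : Tendsto (fun T : ℕ => ∫ s, w T (F g s) / T ∂ν) atTop (𝓝 (∫ s, v (F g s) ∂ν)) :=
    tendsto_integral_of_dominated_convergence (fun _ => C)
      (fun T => (((hwm T).comp (hFm g)).div_const _).aestronglyMeasurable) (integrable_const _)
      (fun T => .of_forall fun s => abs_div_natCast_le hC (hwC T _))
      (.of_forall fun s => hv _)
  have hr : Tendsto (fun T : ℕ => (T : ℝ) / (T + 1)) atTop (𝓝 1) :=
    tendsto_natCast_div_add_atTop 1
  have hk : Tendsto (fun T : ℕ => k g / ((T : ℝ) + 1)) atTop (𝓝 0) :=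
    tendsto_const_nhds.div_atTop (tendsto_natCast_atTop_atTop.atTop_add tendsto_const_nhds)
  have h1 := (tendsto_add_atTop_iff_nat 1).2 (hv (p g))
  have h2 := hk.add (hr.mul hlim)
  rw [zero_add, one_mul] at h2
  refine le_of_tendsto_of_tendsto h1 h2 ?_
  filter_upwards [eventually_gt_atTop 0] with T hT
  have hT' : (0 : ℝ) < T := by exact_mod_cast hT
  rw [integral_div, div_mul_div_comm, mul_comm ((T : ℝ) + 1), mul_div_mul_left _ _ hT'.ne',
    ← add_div, Nat.cast_add_one]
  gcongr
  exact hw T g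

omit [CompactSpace X] in
theorem integral_le_of_tendsto_value (hp : Continuous p) (hFc : ∀ s, Continuous fun g => F g s)
    (hFm : ∀ g, Measurable (F g)) (hk : Continuous k) (hC : 0 ≤ C)
    (hw0 : ∀ x, w 0 x = 0)
    (hwm : ∀ T, Measurable (w T)) (hwC : ∀ T x, |w T x| ≤ T * C)
    (hw : ∀ T g, w (T + 1) (p g) ≤ k g + ∫ s, w T (F g s) ∂ν)
    {v : X → ℝ} (hv : ∀ x, Tendsto (fun T : ℕ => w T x / T) atTop (𝓝 (v x)))
    {γ : Measure G} [IsFiniteMeasure γ]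
    (hγ : ∀ η : C(X, ℝ), ∫ g, ∫ s, η (F g s) ∂ν ∂γ = ∫ g, η (p g) ∂γ) :
    ∫ g, v (p g) ∂γ ≤ ∫ g, k g ∂γ := by
  have hF := measurable_uncurry_dynamics hFc hFm
  have hwi (T : ℕ) : Integrable (fun g => w T (p g)) γ :=
    .of_bound ((hwm T).comp hp.measurable).aestronglyMeasurable _ (.of_forall fun g => hwC T _)
  have hki : Integrable k γ := hk.integrable_of_hasCompactSupport (.of_compactSpace _)
  have hsum (T : ℕ) : ∫ g, w T (p g) ∂γ ≤ T * ∫ g, k g ∂γ := by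
    induction T with
    | zero => simp [hw0]
    | succ T ih =>
      have hPi : Integrable (fun g => ∫ s, w T (F g s) ∂ν) γ :=
        (Integrable.of_bound (μ := γ.prod ν) (f := fun z => w T (Function.uncurry F z))
          ((hwm T).comp hF).aestronglyMeasurable _ (.of_forall fun z => hwC T _)).integral_prod_left
      calc ∫ g, w (T + 1) (p g) ∂γ ≤ ∫ g, (k g + ∫ s, w T (F g s) ∂ν) ∂γ :=
            integral_mono (hwi _) (hki.add hPi) (hw T)
        _ = ∫ g, k g ∂γ + ∫ g, w T (p g) ∂γ := by
            rw [integral_add hki hPi,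
              integral_eq_of_forall_continuous_integral_eq hp hFc hFm hγ (hwm T) (hwC T)]
        _ ≤ (T + 1 : ℕ) * ∫ g, k g ∂γ := by push_cast; linarith
  have hlim : Tendsto (fun T : ℕ => ∫ g, w T (p g) / T ∂γ) atTop (𝓝 (∫ g, v (p g) ∂γ)) :=
    tendsto_integral_of_dominated_convergence (fun _ => C)
      (fun T => (((hwm T).comp hp.measurable).div_const _).aestronglyMeasurable)
      (integrable_const _)
      (fun T => .of_forall fun s => abs_div_natCast_le hC (hwC T _))
      (.of_forall fun s => hv _)
  refine le_of_tendsto hlim ?_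
  filter_upwards [eventually_gt_atTop 0] with T hT
  rw [integral_div, div_le_iff₀ (by exact_mod_cast hT), mul_comm]
  exact hsum T

omit [MetricSpace G] [CompactSpace G] [MeasurableSpace G] [BorelSpace G] in
/-- Weak duality along the value iteration. -/
theorem value_ge_of_dual_feasible (hFm : ∀ g, Measurable (F g)) (hw0 : ∀ x, w 0 x = 0)
    (hwm : ∀ T, Measurable (w T)) (hwC : ∀ T x, |w T x| ≤ T * C)
    (hw : ∀ T x, ∃ g, p g = x ∧ k g + ∫ s, w T (F g s) ∂ν ≤ w (T + 1) x)
    {v : X → ℝ} (hv : ∀ x, Tendsto (fun T : ℕ => w T x / T) atTop (𝓝 (v x)))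
    (ψ η : C(X, ℝ)) {c : ℝ}
    (h1 : ∀ g, c ≤ k g - ψ (p g) + ∫ s, η (F g s) ∂ν - η (p g))
    (h2 : ∀ g, ψ (p g) ≤ ∫ s, ψ (F g s) ∂ν) (x : X) : c + ψ x ≤ v x := by
  have hci (φ : C(X, ℝ)) (g : G) : Integrable (fun s => φ (F g s)) ν :=
    integrable_dynamics hFm φ.continuous.measurable φ.norm_coe_le_norm g
  have key (T : ℕ) : ∀ x, T * (c + ψ x) + η x - ‖η‖ ≤ w T x := by
    induction T with
    | zero => intro x; simpa [hw0] using η.apply_le_norm x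
    | succ T ih =>
      intro x
      obtain ⟨g, rfl, hg⟩ := hw T x
      have hi₁ : Integrable (fun s => (T : ℝ) * (c + ψ (F g s))) ν :=
        ((integrable_const c).add (hci ψ g)).const_mul _
      have hi₂ : Integrable (fun s => (T : ℝ) * (c + ψ (F g s)) + η (F g s)) ν :=
        hi₁.add (hci η g)
      have hm := integral_mono (hi₂.sub (integrable_const ‖η‖))
        (integrable_dynamics hFm (hwm T) (hwC T) g) fun s => ih _
      simp only [Pi.sub_apply] at hm
      rw [integral_sub hi₂ (integrable_const _), integral_add hi₁ (hci η g),
        integral_const_mul, integral_add (integrable_const c) (hci ψ g)] at hm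
      simp only [integral_const, probReal_univ, one_smul] at hm
      have h3 : (T : ℝ) * ψ (p g) ≤ T * ∫ s, ψ (F g s) ∂ν := by gcongr; exact h2 g
      have h4 := h1 g
      push_cast
      linarith
  have hz : Tendsto (fun T : ℕ => (η x - ‖η‖) / (T : ℝ)) atTop (𝓝 0) :=
    tendsto_const_nhds.div_atTop tendsto_natCast_atTop_atTop
  have hlim := (tendsto_const_nhds (x := c + ψ x)).add hz
  rw [add_zero] at hlim
  refine le_of_tendsto_of_tendsto hlim (hv x) ?_
  filter_upwards [eventually_gt_atTop 0] with T hT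
  have hT' : (0 : ℝ) < T := by exact_mod_cast hT
  rw [le_div_iff₀ hT', add_mul, div_mul_cancel₀ _ hT'.ne']
  linarith [key T x]

end ValueIteration

end Abstract

section Dynamics

variable (M : Model n Uc S)

instance : IsProbabilityMeasure M.ν := M.ν_prob

instance : CompactSpace M.Y := isCompact_iff_compactSpace.1 M.Y_compact

instance : CompactSpace (graphG M) :=
  isCompact_iff_compactSpace.1 <|
    (M.Y_compact.prod isCompact_univ).of_isClosed_subset M.graph_closed fun _ h => ⟨h.1, trivial⟩

/-- The one step dynamics on the graph. -/
def dyn (g : graphG M) (s : S) : M.Y := ⟨M.f g.1.1 g.1.2 s, M.f_inv _ g.2.1 _ g.2.2 s⟩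

/-- The projection of the graph onto the state space. -/
def proj (g : graphG M) : M.Y := ⟨g.1.1, g.2.1⟩

theorem continuous_proj : Continuous (proj M) :=
  (continuous_fst.comp continuous_subtype_val).subtype_mk _

theorem proj_surjective : Function.Surjective (proj M) := fun y =>
  have ⟨u, hu⟩ := M.U_nonempty y y.2
  ⟨⟨(y, u), y.2, hu⟩, rfl⟩

theorem continuous_dyn (s : S) : Continuous fun g => dyn M g s :=
  ((M.f_cont s).comp_continuous continuous_subtype_val fun g => ⟨g.2.1, trivial⟩).subtype_mk _

theorem measurable_dyn (g : graphG M) : Measurable (dyn M g) :=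
  (M.f_meas _ g.2.1 _).subtype_mk

theorem measurable_uncurry_dyn : Measurable (Function.uncurry (dyn M)) :=
  measurable_uncurry_dynamics (continuous_dyn M) (measurable_dyn M)

theorem Ef_eq_integral_dyn (φ : (Fin n → ℝ) → ℝ) (g : graphG M) :
    Ef M φ g.1.1 g.1.2 = ∫ s, φ (dyn M g s) ∂M.ν := rfl

variable {M}

/-- The section of the graph defined by the control plan at time `t`. -/
def Plan.sec (π : Plan M) (t : ℕ) (y : M.Y) : graphG M :=
  ⟨(y, π.π t y), y.2, π.feasible t y y.2⟩

theorem Plan.measurable_sec (π : Plan M) (t : ℕ) : Measurable (π.sec t) :=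
  (measurable_subtype_coe.prodMk ((π.measurable t).comp measurable_subtype_coe)).subtype_mk

/-- The control plan obtained by dropping the first selection. -/
def Plan.shift (π : Plan M) : Plan M :=
  ⟨fun t => π.π (t + 1), fun t => π.measurable (t + 1), fun t => π.feasible (t + 1)⟩

/-- The control plan obtained by inserting a selection at time `0`. -/
def Plan.cons (e : (Fin n → ℝ) → Uc) (he : Measurable e) (hf : ∀ y ∈ M.Y, e y ∈ M.U y)
    (π : Plan M) : Plan M :=
  ⟨fun t => Nat.casesOn t e π.π, fun t => Nat.casesOn t he π.measurable,
    fun t => Nat.casesOn t hf π.feasible⟩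

theorem exists_measurable_extension_section {σ : M.Y → graphG M} (hσ : Measurable σ)
    (hs : ∀ y, proj M (σ y) = y) :
    ∃ e : (Fin n → ℝ) → Uc, Measurable e ∧ (∀ y ∈ M.Y, e y ∈ M.U y) ∧
      ∀ y : M.Y, (σ y).1 = (y.1, e y) := by
  obtain ⟨y₀, hy₀⟩ := M.Y_nonempty
  have : Nonempty Uc := ⟨(M.U_nonempty y₀ hy₀).some⟩
  obtain ⟨e, he, hee⟩ := (MeasurableEmbedding.subtype_coe
    M.Y_compact.isClosed.measurableSet).exists_measurable_extend
    ((measurable_snd.comp measurable_subtype_coe).comp hσ) fun _ => this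
  have hσe (y : M.Y) : (σ y).1 = (y.1, e y) :=
    Prod.ext (congrArg Subtype.val (hs y)) (congrFun hee y).symm
  refine ⟨e, he, fun y hy => ?_, hσe⟩
  have := (σ ⟨y, hy⟩).2.2
  rwa [hσe ⟨y, hy⟩] at this

theorem stateLaw_zero (π : ℕ → (Fin n → ℝ) → Uc) (y : Fin n → ℝ) :
    stateLaw M 0 π y = Measure.dirac y := rfl

theorem stateLaw_succ (t : ℕ) (π : ℕ → (Fin n → ℝ) → Uc) (y : Fin n → ℝ) :
    stateLaw M (t + 1) π y =
      (M.ν.map fun s => M.f y (π 0 y) s).bind (stateLaw M t fun j => π (j + 1)) := rfl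

theorem aemeasurable_map_dyn {κ : (Fin n → ℝ) → Measure (Fin n → ℝ)}
    (hκ : Measurable fun y : M.Y => κ y) (g : graphG M) :
    AEMeasurable κ (M.ν.map fun s => M.f g.1.1 g.1.2 s) := by
  have : (M.ν.map fun s => M.f g.1.1 g.1.2 s) = (M.ν.map (dyn M g)).map Subtype.val :=
    (Measure.map_map measurable_subtype_coe (measurable_dyn M g)).symm
  rw [this, (MeasurableEmbedding.subtype_coe
    M.Y_compact.isClosed.measurableSet).aemeasurable_map_iff]
  exact hκ.aemeasurable

theorem lintegral_bind_map_dyn {κ : (Fin n → ℝ) → Measure (Fin n → ℝ)}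
    (hκ : Measurable fun y : M.Y => κ y) (g : graphG M) {φ : (Fin n → ℝ) → ℝ≥0∞}
    (hφ : Measurable φ) :
    ∫⁻ z, φ z ∂((M.ν.map fun s => M.f g.1.1 g.1.2 s).bind κ) =
      ∫⁻ s, ∫⁻ z, φ z ∂κ (dyn M g s) ∂M.ν := by
  have hae := aemeasurable_map_dyn hκ g
  rw [Measure.lintegral_bind hae hφ.aemeasurable]
  exact lintegral_map' ((Measure.measurable_lintegral hφ).comp_aemeasurable hae)
    (M.f_meas _ g.2.1 _).aemeasurable

theorem measurable_stateLaw (t : ℕ) (π : Plan M) :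
    Measurable fun y : M.Y => stateLaw M t π.π y := by
  induction t generalizing π with
  | zero => exact Measure.measurable_dirac.comp measurable_subtype_coe
  | succ t ih =>
    refine Measure.measurable_of_measurable_coe _ fun A hA => ?_
    have h : (fun y : M.Y => stateLaw M (t + 1) π.π y A) = fun y =>
        ∫⁻ s, stateLaw M t π.shift.π (dyn M (π.sec 0 y) s) A ∂M.ν := by
      ext y
      rw [← lintegral_indicator_one hA, stateLaw_succ]
      refine (lintegral_bind_map_dyn (ih π.shift) (π.sec 0 y)
        (measurable_one.indicator hA)).trans (lintegral_congr fun s => ?_)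
      exact lintegral_indicator_one hA
    rw [h]
    have hj : Measurable fun z : M.Y × S => dyn M (π.sec 0 z.1) z.2 :=
      (measurable_uncurry_dyn M).comp
        (((π.measurable_sec 0).comp measurable_fst).prodMk measurable_snd)
    exact (((Measure.measurable_coe hA).comp (ih π.shift)).comp hj).lintegral_prod_right'

theorem lintegral_stateLaw_succ (t : ℕ) (π : Plan M) (y : M.Y) {φ : (Fin n → ℝ) → ℝ≥0∞}
    (hφ : Measurable φ) :
    ∫⁻ z, φ z ∂stateLaw M (t + 1) π.π y =
      ∫⁻ s, ∫⁻ z, φ z ∂stateLaw M t π.shift.π (dyn M (π.sec 0 y) s) ∂M.ν :=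
  lintegral_bind_map_dyn (measurable_stateLaw t π.shift) (π.sec 0 y) hφ

theorem stateLaw_apply_eq {A : Set (Fin n → ℝ)} (hA : MeasurableSet A) {r : ℝ≥0∞}
    (hr : ∀ y : M.Y, A.indicator 1 y.1 = r) (t : ℕ) (π : Plan M) (y : M.Y) :
    stateLaw M t π.π y A = r := by
  induction t generalizing π y with
  | zero => rw [stateLaw_zero, Measure.dirac_apply' _ hA, hr]
  | succ t ih =>
    rw [← lintegral_indicator_one hA, lintegral_stateLaw_succ t π y (measurable_one.indicator hA)]
    simp [lintegral_indicator_one hA, ih]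

theorem isProbabilityMeasure_stateLaw (t : ℕ) (π : Plan M) (y : M.Y) :
    IsProbabilityMeasure (stateLaw M t π.π y) :=
  ⟨stateLaw_apply_eq MeasurableSet.univ (by simp) t π y⟩

theorem stateLaw_compl (t : ℕ) (π : Plan M) (y : M.Y) : stateLaw M t π.π y M.Yᶜ = 0 :=
  stateLaw_apply_eq M.Y_compact.isClosed.measurableSet.compl (by simp) t π y

/-- The total expected cost of a control plan for a nonnegative running cost. -/
def totalCost (M : Model n Uc S) (c : (Fin n → ℝ) × Uc → ℝ≥0∞) (T : ℕ)
    (π : ℕ → (Fin n → ℝ) → Uc) (y : Fin n → ℝ) : ℝ≥0∞ :=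
  ∑ t ∈ Finset.range T, ∫⁻ z, c (z, π t z) ∂stateLaw M t π y

variable {c : (Fin n → ℝ) × Uc → ℝ≥0∞}

theorem totalCost_succ (hc : Measurable c) (T : ℕ) (π : Plan M) (y : M.Y) :
    totalCost M c (T + 1) π.π y =
      c (π.sec 0 y) + ∫⁻ s, totalCost M c T π.shift.π (dyn M (π.sec 0 y) s) ∂M.ν := by
  have hφ (t : ℕ) : Measurable fun z => c (z, π.π t z) :=
    hc.comp (measurable_id.prodMk (π.measurable t))
  rw [totalCost, Finset.sum_range_succ', add_comm, stateLaw_zero, lintegral_dirac' _ (hφ 0)]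
  congr 1
  unfold totalCost
  rw [lintegral_finsetSum]
  · exact Finset.sum_congr rfl fun t _ => lintegral_stateLaw_succ t π y (hφ (t + 1))
  · exact fun t _ => ((Measure.measurable_lintegral (hφ (t + 1))).comp
      (measurable_stateLaw t π.shift)).comp (measurable_dyn M _)

/-- The optimal total expected cost. -/
def optCost (M : Model n Uc S) (c : (Fin n → ℝ) × Uc → ℝ≥0∞) (T : ℕ) (y : M.Y) : ℝ≥0∞ :=
  ⨅ π : Plan M, totalCost M c T π.π y

/-- The right hand side of the dynamic programming equation. -/
def bellman (M : Model n Uc S) (c : (Fin n → ℝ) × Uc → ℝ≥0∞) (T : ℕ) (g : graphG M) : ℝ≥0∞ :=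
  c g + ∫⁻ s, optCost M c T (dyn M g s) ∂M.ν

theorem bellman_le_totalCost (hc : Measurable c) (T : ℕ) (π : Plan M) (y : M.Y) :
    bellman M c T (π.sec 0 y) ≤ totalCost M c (T + 1) π.π y := by
  rw [totalCost_succ hc]
  exact add_le_add_right (lintegral_mono fun s => iInf_le _ _) _

theorem lowerSemicontinuous_bellman (hcc : Continuous fun g : graphG M => c g) {T : ℕ}
    (hT : LowerSemicontinuous (optCost M c T)) : LowerSemicontinuous (bellman M c T) :=
  hcc.lowerSemicontinuous.add
    (lowerSemicontinuous_lintegral_dynamics (continuous_dyn M) (measurable_dyn M) hT)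

theorem exists_selector_optCost_succ (hc : Measurable c)
    (hcc : Continuous fun g : graphG M => c g) {T : ℕ}
    (hT : LowerSemicontinuous (optCost M c T))
    (hπ : ∃ π : Plan M, ∀ y : M.Y, totalCost M c T π.π y = optCost M c T y) :
    ∃ σ : M.Y → graphG M, (∀ y, proj M (σ y) = y) ∧
      (∀ y, optCost M c (T + 1) y = bellman M c T (σ y)) ∧
      (∀ g, bellman M c T (σ (proj M g)) ≤ bellman M c T g) ∧
      LowerSemicontinuous (optCost M c (T + 1)) ∧
      ∃ π : Plan M, ∀ y : M.Y, totalCost M c (T + 1) π.π y = optCost M c (T + 1) y := by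
  obtain ⟨π, hπ⟩ := hπ
  obtain ⟨σ, hσ, hs, hmin, hlsc⟩ := exists_measurable_argmin_section (continuous_proj M)
    (proj_surjective M) (lowerSemicontinuous_bellman hcc hT)
  obtain ⟨e, he, hef, hσe⟩ := exists_measurable_extension_section hσ hs
  have hcons (y : M.Y) :
      totalCost M c (T + 1) (Plan.cons e he hef π).π y = bellman M c T (σ y) := by
    have h0 : (Plan.cons e he hef π).sec 0 y = σ y := Subtype.ext (hσe y).symm
    rw [totalCost_succ hc, h0, bellman]
    exact congrArg _ (lintegral_congr fun s => hπ _)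
  have hopt (y : M.Y) : optCost M c (T + 1) y = bellman M c T (σ y) :=
    le_antisymm ((iInf_le _ _).trans_eq (hcons y)) <| le_iInf fun π' =>
      (hmin (π'.sec 0 y)).trans (bellman_le_totalCost hc T π' y)
  refine ⟨σ, hs, hopt, hmin, ?_, _, fun y => (hcons y).trans (hopt y).symm⟩
  rwa [funext hopt]

theorem nonempty_plan (M : Model n Uc S) : Nonempty (Plan M) := by
  obtain ⟨σ, hσ, hs, -⟩ := exists_measurable_argmin_section (continuous_proj M)
    (proj_surjective M) (h := 0) lowerSemicontinuous_const
  obtain ⟨e, he, hef, -⟩ := exists_measurable_extension_section hσ hs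
  exact ⟨⟨fun _ => e, fun _ => he, fun _ => hef⟩⟩

theorem optCost_zero (M : Model n Uc S) (c : (Fin n → ℝ) × Uc → ℝ≥0∞) : optCost M c 0 = 0 := by
  have := nonempty_plan M
  ext y
  simp [optCost, totalCost]

theorem lowerSemicontinuous_optCost_and_attained (hc : Measurable c)
    (hcc : Continuous fun g : graphG M => c g) (T : ℕ) :
    LowerSemicontinuous (optCost M c T) ∧
      ∃ π : Plan M, ∀ y : M.Y, totalCost M c T π.π y = optCost M c T y := by
  induction T with
  | zero =>
    rw [optCost_zero]
    exact ⟨lowerSemicontinuous_const, (nonempty_plan M).some, fun y => by simp [totalCost]⟩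
  | succ T ih =>
    obtain ⟨σ, -, -, -, h⟩ := exists_selector_optCost_succ hc hcc ih.1 ih.2
    exact h

theorem optCost_succ_le (hc : Measurable c) (hcc : Continuous fun g : graphG M => c g) (T : ℕ)
    (g : graphG M) : optCost M c (T + 1) (proj M g) ≤ bellman M c T g := by
  have ih := lowerSemicontinuous_optCost_and_attained hc hcc T
  obtain ⟨σ, -, hopt, hmin, -⟩ := exists_selector_optCost_succ hc hcc ih.1 ih.2
  exact (hopt _).trans_le (hmin g)

theorem exists_optCost_succ_eq (hc : Measurable c) (hcc : Continuous fun g : graphG M => c g)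
    (T : ℕ) (y : M.Y) : ∃ g, proj M g = y ∧ optCost M c (T + 1) y = bellman M c T g := by
  have ih := lowerSemicontinuous_optCost_and_attained hc hcc T
  obtain ⟨σ, hs, hopt, -⟩ := exists_selector_optCost_succ hc hcc ih.1 ih.2
  exact ⟨σ y, hs y, hopt y⟩

end Dynamics

section RealCost

variable (M : Model n Uc S) (k : (Fin n → ℝ) → Uc → ℝ) (C : ℝ)

/-- The running cost on the state constraint set, shifted so as to be nonnegative. -/
def shiftedCost : (Fin n → ℝ) × Uc → ℝ≥0∞ :=
  (M.Y ×ˢ univ).indicator fun p => ENNReal.ofReal (k p.1 p.2 + C)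

variable {M k C}

theorem measurable_shiftedCost
    (hk : ContinuousOn (fun p : (Fin n → ℝ) × Uc => k p.1 p.2) (M.Y ×ˢ (univ : Set Uc))) :
    Measurable (shiftedCost M k C) := by
  classical
  rw [shiftedCost, ← Set.piecewise_eq_indicator]
  exact (ENNReal.continuous_ofReal.comp_continuousOn
    (hk.add continuousOn_const)).measurable_piecewise continuousOn_const
    (M.Y_compact.isClosed.measurableSet.prod MeasurableSet.univ)

theorem shiftedCost_eq {p : (Fin n → ℝ) × Uc} (hp : p.1 ∈ M.Y) :
    shiftedCost M k C p = ENNReal.ofReal (k p.1 p.2 + C) :=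
  indicator_of_mem (s := M.Y ×ˢ univ) ⟨hp, trivial⟩ _

theorem continuous_cost
    (hk : ContinuousOn (fun p : (Fin n → ℝ) × Uc => k p.1 p.2) (M.Y ×ˢ (univ : Set Uc))) :
    Continuous fun g : graphG M => k g.1.1 g.1.2 :=
  hk.comp_continuous continuous_subtype_val fun g => ⟨g.2.1, trivial⟩

theorem continuous_shiftedCost
    (hk : ContinuousOn (fun p : (Fin n → ℝ) × Uc => k p.1 p.2) (M.Y ×ˢ (univ : Set Uc))) :
    Continuous fun g : graphG M => shiftedCost M k C g := by
  simp_rw [fun g : graphG M => shiftedCost_eq (k := k) (C := C) g.2.1]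
  exact ENNReal.continuous_ofReal.comp ((continuous_cost hk).add continuous_const)

theorem shiftedCost_le (hkC : ∀ y ∈ M.Y, ∀ u : Uc, |k y u| ≤ C) (p : (Fin n → ℝ) × Uc) :
    shiftedCost M k C p ≤ ENNReal.ofReal (2 * C) :=
  indicator_le' (fun p hp => ENNReal.ofReal_le_ofReal
    (by linarith [(abs_le.1 (hkC p.1 hp.1 p.2)).2])) (fun _ _ => zero_le) p

theorem toReal_shiftedCost (hkC : ∀ y ∈ M.Y, ∀ u : Uc, |k y u| ≤ C) {p : (Fin n → ℝ) × Uc}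
    (hp : p.1 ∈ M.Y) : (shiftedCost M k C p).toReal = k p.1 p.2 + C := by
  rw [shiftedCost_eq hp, ENNReal.toReal_ofReal]
  linarith [(abs_le.1 (hkC p.1 hp p.2)).1]

theorem lintegral_shiftedCost_le (hkC : ∀ y ∈ M.Y, ∀ u : Uc, |k y u| ≤ C) (t : ℕ) (π : Plan M)
    (y : M.Y) : ∫⁻ z, shiftedCost M k C (z, π.π t z) ∂stateLaw M t π.π y ≤
      ENNReal.ofReal (2 * C) := by
  have := isProbabilityMeasure_stateLaw t π y
  simpa using lintegral_mono (μ := stateLaw M t π.π y)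
    fun z => shiftedCost_le hkC (z, π.π t z)

theorem totalCost_shiftedCost_le (hkC : ∀ y ∈ M.Y, ∀ u : Uc, |k y u| ≤ C) (T : ℕ) (π : Plan M)
    (y : M.Y) : totalCost M (shiftedCost M k C) T π.π y ≤ T * ENNReal.ofReal (2 * C) := by
  refine (Finset.sum_le_card_nsmul _ _ _
    fun t _ => lintegral_shiftedCost_le hkC t π y).trans_eq ?_
  rw [Finset.card_range, nsmul_eq_mul]

theorem natCast_mul_ofReal_ne_top (T : ℕ) (r : ℝ) : (T : ℝ≥0∞) * ENNReal.ofReal r ≠ ⊤ :=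
  ENNReal.mul_ne_top (ENNReal.natCast_ne_top T) ENNReal.ofReal_ne_top

theorem optCost_shiftedCost_le (hkC : ∀ y ∈ M.Y, ∀ u : Uc, |k y u| ≤ C) (T : ℕ) (y : M.Y) :
    optCost M (shiftedCost M k C) T y ≤ T * ENNReal.ofReal (2 * C) :=
  (iInf_le _ (nonempty_plan M).some).trans (totalCost_shiftedCost_le hkC T _ y)

theorem expSA_eq
    (hk : ContinuousOn (fun p : (Fin n → ℝ) × Uc => k p.1 p.2) (M.Y ×ˢ (univ : Set Uc)))
    (hkC : ∀ y ∈ M.Y, ∀ u : Uc, |k y u| ≤ C) (t : ℕ) (π : Plan M) (y : M.Y) :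
    expSA M t π.π y k =
      (∫⁻ z, shiftedCost M k C (z, π.π t z) ∂stateLaw M t π.π y).toReal - C := by
  have := isProbabilityMeasure_stateLaw t π y
  have hm : Measurable fun z => (z, π.π t z) := measurable_id.prodMk (π.measurable t)
  have hprob : IsProbabilityMeasure (saLaw M t π.π y) :=
    Measure.isProbabilityMeasure_map hm.aemeasurable
  have hc := measurable_shiftedCost (C := C) hk
  have hl : ∫⁻ p, shiftedCost M k C p ∂saLaw M t π.π y =
      ∫⁻ z, shiftedCost M k C (z, π.π t z) ∂stateLaw M t π.π y := lintegral_map hc hm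
  have hae : ∀ᵐ p ∂saLaw M t π.π y, k p.1 p.2 = (shiftedCost M k C p).toReal - C := by
    have hY : ∀ᵐ p ∂saLaw M t π.π y, p.1 ∈ M.Y :=
      (ae_map_iff hm.aemeasurable
        (measurable_fst M.Y_compact.isClosed.measurableSet)).2 (stateLaw_compl t π y)
    filter_upwards [hY] with p hp
    rw [toReal_shiftedCost hkC hp, add_sub_cancel_right]
  have hfin : ∫⁻ p, shiftedCost M k C p ∂saLaw M t π.π y ≠ ⊤ :=
    hl ▸ ((lintegral_shiftedCost_le hkC t π y).trans_lt ENNReal.ofReal_lt_top).ne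
  rw [expSA, integral_congr_ae hae,
    integral_sub (integrable_toReal_of_lintegral_ne_top hc.aemeasurable hfin)
      (integrable_const C), integral_toReal hc.aemeasurable (ae_lt_top hc hfin), hl]
  simp

theorem costT_eq
    (hk : ContinuousOn (fun p : (Fin n → ℝ) × Uc => k p.1 p.2) (M.Y ×ˢ (univ : Set Uc)))
    (hkC : ∀ y ∈ M.Y, ∀ u : Uc, |k y u| ≤ C) (T : ℕ) (π : Plan M) (y : M.Y) :
    costT M k T π.π y =
      ((totalCost M (shiftedCost M k C) T π.π y).toReal - T * C) / T := by
  rw [costT, Finset.sum_congr rfl fun t _ => expSA_eq hk hkC t π y, totalCost, ENNReal.toReal_sum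
    fun t _ => ((lintegral_shiftedCost_le hkC t π y).trans_lt ENNReal.ofReal_lt_top).ne]
  simp [Finset.sum_sub_distrib, div_eq_inv_mul]

/-- The optimal value of the total, not averaged, cost over a finite horizon. -/
def totalValue (M : Model n Uc S) (k : (Fin n → ℝ) → Uc → ℝ) (C : ℝ) (T : ℕ) (y : M.Y) : ℝ :=
  (optCost M (shiftedCost M k C) T y).toReal - T * C

theorem totalValue_zero (y : M.Y) : totalValue M k C 0 y = 0 := by
  simp [totalValue, optCost_zero]

theorem vT_eq
    (hk : ContinuousOn (fun p : (Fin n → ℝ) × Uc => k p.1 p.2) (M.Y ×ˢ (univ : Set Uc)))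
    (hkC : ∀ y ∈ M.Y, ∀ u : Uc, |k y u| ≤ C) (T : ℕ) (y : M.Y) :
    vT M k T y = totalValue M k C T y / T := by
  obtain ⟨π, hπ⟩ := (lowerSemicontinuous_optCost_and_attained (measurable_shiftedCost (C := C) hk)
    (continuous_shiftedCost hk) T).2
  have := nonempty_plan M
  have hle (π' : Plan M) : totalValue M k C T y / T ≤ costT M k T π'.π y := by
    rw [costT_eq hk hkC, totalValue]
    gcongr
    · exact ((totalCost_shiftedCost_le hkC T π' y).trans_lt
        (natCast_mul_ofReal_ne_top T _).lt_top).ne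
    · exact iInf_le _ π'
  refine le_antisymm ((ciInf_le ⟨_, forall_mem_range.2 hle⟩ π).trans_eq ?_) (le_ciInf hle)
  rw [costT_eq hk hkC, hπ, totalValue]

theorem measurable_totalValue
    (hk : ContinuousOn (fun p : (Fin n → ℝ) × Uc => k p.1 p.2) (M.Y ×ˢ (univ : Set Uc)))
    (T : ℕ) : Measurable (totalValue M k C T) :=
  (lowerSemicontinuous_optCost_and_attained (measurable_shiftedCost (C := C) hk)
    (continuous_shiftedCost hk) T).1.measurable.ennreal_toReal.sub_const _

theorem nonneg_of_abs_cost_le (hkC : ∀ y ∈ M.Y, ∀ u : Uc, |k y u| ≤ C) : 0 ≤ C := by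
  obtain ⟨y, hy⟩ := M.Y_nonempty
  obtain ⟨u, -⟩ := M.U_nonempty y hy
  exact (abs_nonneg _).trans (hkC y hy u)

theorem abs_totalValue_le (hkC : ∀ y ∈ M.Y, ∀ u : Uc, |k y u| ≤ C) (T : ℕ) (y : M.Y) :
    |totalValue M k C T y| ≤ T * C := by
  have h := ENNReal.toReal_mono (natCast_mul_ofReal_ne_top T _) (optCost_shiftedCost_le hkC T y)
  rw [ENNReal.toReal_mul, ENNReal.toReal_natCast,
    ENNReal.toReal_ofReal (by linarith [nonneg_of_abs_cost_le hkC])] at h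
  rw [totalValue, abs_le]
  constructor <;> linarith [ENNReal.toReal_nonneg (a := optCost M (shiftedCost M k C) T y)]

theorem lintegral_optCost_ne_top (hkC : ∀ y ∈ M.Y, ∀ u : Uc, |k y u| ≤ C) (T : ℕ)
    (g : graphG M) : ∫⁻ s, optCost M (shiftedCost M k C) T (dyn M g s) ∂M.ν ≠ ⊤ := by
  refine (lintegral_mono fun s => optCost_shiftedCost_le hkC T (dyn M g s)).trans_lt ?_ |>.ne
  simpa using (natCast_mul_ofReal_ne_top T (2 * C)).lt_top

theorem bellman_ne_top (hkC : ∀ y ∈ M.Y, ∀ u : Uc, |k y u| ≤ C) (T : ℕ) (g : graphG M) :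
    bellman M (shiftedCost M k C) T g ≠ ⊤ :=
  ENNReal.add_ne_top.2 ⟨((shiftedCost_le hkC g).trans_lt ENNReal.ofReal_lt_top).ne,
    lintegral_optCost_ne_top hkC T g⟩

theorem toReal_bellman
    (hk : ContinuousOn (fun p : (Fin n → ℝ) × Uc => k p.1 p.2) (M.Y ×ˢ (univ : Set Uc)))
    (hkC : ∀ y ∈ M.Y, ∀ u : Uc, |k y u| ≤ C) (T : ℕ) (g : graphG M) :
    (bellman M (shiftedCost M k C) T g).toReal - (T + 1 : ℕ) * C =
      k g.1.1 g.1.2 + ∫ s, totalValue M k C T (dyn M g s) ∂M.ν := by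
  have hne := lintegral_optCost_ne_top hkC T g
  have hm : Measurable fun s => optCost M (shiftedCost M k C) T (dyn M g s) :=
    (lowerSemicontinuous_optCost_and_attained (measurable_shiftedCost (C := C) hk)
      (continuous_shiftedCost hk) T).1.measurable.comp (measurable_dyn M g)
  rw [bellman, ENNReal.toReal_add ((shiftedCost_le hkC g).trans_lt ENNReal.ofReal_lt_top).ne hne,
    toReal_shiftedCost hkC g.2.1]
  unfold totalValue
  rw [integral_sub (integrable_toReal_of_lintegral_ne_top hm.aemeasurable hne)
    (integrable_const _), integral_toReal hm.aemeasurable (ae_lt_top hm hne)]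
  simp only [integral_const, probReal_univ, one_smul]
  push_cast
  ring

theorem totalValue_succ_le
    (hk : ContinuousOn (fun p : (Fin n → ℝ) × Uc => k p.1 p.2) (M.Y ×ˢ (univ : Set Uc)))
    (hkC : ∀ y ∈ M.Y, ∀ u : Uc, |k y u| ≤ C) (T : ℕ) (g : graphG M) :
    totalValue M k C (T + 1) (proj M g) ≤
      k g.1.1 g.1.2 + ∫ s, totalValue M k C T (dyn M g s) ∂M.ν := by
  rw [← toReal_bellman hk hkC, totalValue]
  exact sub_le_sub_right (ENNReal.toReal_mono (bellman_ne_top hkC T g)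
    (optCost_succ_le (measurable_shiftedCost hk) (continuous_shiftedCost hk) T g)) _

theorem exists_totalValue_succ_eq
    (hk : ContinuousOn (fun p : (Fin n → ℝ) × Uc => k p.1 p.2) (M.Y ×ˢ (univ : Set Uc)))
    (hkC : ∀ y ∈ M.Y, ∀ u : Uc, |k y u| ≤ C) (T : ℕ) (y : M.Y) :
    ∃ g, proj M g = y ∧ k g.1.1 g.1.2 + ∫ s, totalValue M k C T (dyn M g s) ∂M.ν =
      totalValue M k C (T + 1) y := by
  obtain ⟨g, hg, h⟩ := exists_optCost_succ_eq (measurable_shiftedCost (C := C) hk)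
    (continuous_shiftedCost hk) T y
  exact ⟨g, hg, by rw [← toReal_bellman hk hkC, totalValue, h]⟩

end RealCost

theorem csSup_eq_of_forall_le_of_forall_sub_le {A : Set ℝ} {a : ℝ} (h1 : ∀ b ∈ A, b ≤ a)
    (h2 : ∀ ε > 0, ∃ b ∈ A, a - ε ≤ b) : sSup A = a := by
  obtain ⟨b, hb, -⟩ := h2 1 one_pos
  refine le_antisymm (csSup_le ⟨b, hb⟩ h1) (le_of_forall_pos_sub_le fun ε hε => ?_)
  obtain ⟨b, hb, h⟩ := h2 ε hε
  exact h.trans (le_csSup ⟨a, h1⟩ hb)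

/-- if `v_T` converges pointwise on `Y` to a continuous function `v`, then
`v(y₀) = d*(y₀)` for every `y₀ ∈ Y`. -/
theorem statement10 (M : Model n Uc S) (k : (Fin n → ℝ) → Uc → ℝ)
    (hk : ContinuousOn (fun p : (Fin n → ℝ) × Uc => k p.1 p.2) (M.Y ×ˢ (univ : Set Uc)))
    (C : ℝ) (hkC : ∀ y ∈ M.Y, ∀ u : Uc, |k y u| ≤ C)
    (v : (Fin n → ℝ) → ℝ)
    (hconv : ∀ y ∈ M.Y, Tendsto (fun T : ℕ => vT M k T y) atTop (𝓝 (v y)))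
    (hvcont : ContinuousOn v M.Y) :
    ∀ y0 ∈ M.Y, v y0 = dStar M k y0 := by
  intro y0 hy0
  have hC := nonneg_of_abs_cost_le hkC
  have hkc := continuous_cost hk
  have hv (y : M.Y) : Tendsto (fun T : ℕ => totalValue M k C T y / T) atTop (𝓝 (v y)) := by
    simpa only [vT_eq hk hkC] using hconv y y.2
  have hext (φ : C(M.Y, ℝ)) : ∃ Φ : C(Fin n → ℝ, ℝ), ∀ y : M.Y, Φ y = φ y := by
    obtain ⟨Φ, hΦ⟩ := φ.exists_restrict_eq M.Y_compact.isClosed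
    exact ⟨Φ, fun y => DFunLike.congr_fun hΦ y⟩
  let vY : C(M.Y, ℝ) := ⟨fun y => v y, hvcont.domRestrict⟩
  have hvp : Continuous fun g : graphG M => vY (proj M g) :=
    vY.continuous.comp (continuous_proj M)
  have hv1 : ∀ g : graphG M, vY (proj M g) ≤ ∫ s, vY (dyn M g s) ∂M.ν :=
    le_integral_of_tendsto_value (p := proj M) (k := fun g : graphG M => k g.1.1 g.1.2)
      (v := vY) (measurable_dyn M) hC
      (measurable_totalValue hk) (abs_totalValue_le hkC) (totalValue_succ_le hk hkC) hv
  symm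
  refine csSup_eq_of_forall_le_of_forall_sub_le ?_ ?_
  · rintro μ ⟨ψ, η, hψ, hη, h1, h2⟩
    have := value_ge_of_dual_feasible (p := proj M) (k := fun g : graphG M => k g.1.1 g.1.2)
      (v := vY) (c := μ - ψ y0) (measurable_dyn M) totalValue_zero (measurable_totalValue hk)
      (abs_totalValue_le hkC)
      (fun T y => (exists_totalValue_succ_eq hk hkC T y).imp fun g h => ⟨h.1, h.2.le⟩) hv
      ⟨fun y => ψ y, hψ.comp continuous_subtype_val⟩ ⟨fun y => η y, hη.comp continuous_subtype_val⟩
      (fun g => by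
        have := h1 g g.2
        rw [Ef_eq_integral_dyn] at this
        change _ ≤ k g.1.1 g.1.2 - ψ g.1.1 + ∫ s, η (dyn M g s) ∂M.ν - η g.1.1
        linarith)
      (fun g => sub_nonneg.1 (h2 g g.2)) ⟨y0, hy0⟩
    change μ - ψ y0 + ψ y0 ≤ v y0 at this
    linarith
  · intro ε hε
    obtain ⟨η, hη⟩ := exists_generator_lower_bound (a := fun g => k g.1.1 g.1.2 - vY (proj M g))
      (ν := M.ν) (continuous_proj M) (continuous_dyn M) (measurable_dyn M)
      (hkc.sub hvp)
      (fun γ _ hγ => by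
        rw [integral_sub (hkc.integrable_of_hasCompactSupport (.of_compactSpace _))
          (hvp.integrable_of_hasCompactSupport (.of_compactSpace _)), sub_nonneg]
        exact integral_le_of_tendsto_value (v := vY) (continuous_proj M) (continuous_dyn M)
          (measurable_dyn M) hkc hC totalValue_zero (measurable_totalValue hk)
          (abs_totalValue_le hkC) (totalValue_succ_le hk hkC) hv hγ) hε
    obtain ⟨Ψ, hΨ⟩ := hext vY
    obtain ⟨H, hH⟩ := hext η
    refine ⟨v y0 - ε, ⟨Ψ, H, Ψ.continuous, H.continuous, fun p hp => ?_, fun p hp => ?_⟩, le_rfl⟩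
    · have h := hη ⟨p, hp⟩
      have e1 : Ψ y0 = v y0 := hΨ ⟨y0, hy0⟩
      have e2 : Ψ p.1 = vY (proj M ⟨p, hp⟩) := hΨ (proj M ⟨p, hp⟩)
      have e3 : H p.1 = η (proj M ⟨p, hp⟩) := hH (proj M ⟨p, hp⟩)
      rw [Ef_eq_integral_dyn M H ⟨p, hp⟩, e1, e2, e3]
      simp_rw [hH]
      linarith
    · have h := hv1 ⟨p, hp⟩
      have e2 : Ψ p.1 = vY (proj M ⟨p, hp⟩) := hΨ (proj M ⟨p, hp⟩)
      rw [Ef_eq_integral_dyn M Ψ ⟨p, hp⟩, e2, sub_nonneg]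
      simp_rw [hΨ]
      exact h

end StochLP
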